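/- arXiv:2109.11502 — 8 statements merged into one kernel-verified Lean document; each statement's English description precedes it below -/
import Mathlib

section
/- Let J ∈ ℝ^{m×d}, G ∈ ℝ^{r×d}, and g ∈ ℝ^r. Suppose the family of vectors in ℝ^d consisting of the m rows of J together with the rows G_i of G for those indices i with g_i = 0 is linearly independent. Then the symmetric matrix M = [[JJᵀ, JGᵀ], [GJᵀ, GGᵀ + diag(g)²]] ∈ ℝ^{(m+r)×(m+r)} is positive definite. -/
open Matrix in
/-- If the rows of `J` and the rows `Gᵢ` of `G` with `gᵢ = 0` are linearly independent, then
`[[J, 0], [G, diag(g)]]` has trivial left kernel. -/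
theorem vecMul_fromBlocks_diagonal_injective {𝕜 d m r : Type*} [Field 𝕜] [Fintype m]
    [Fintype r] [DecidableEq r] (J : Matrix m d 𝕜) (G : Matrix r d 𝕜) (g : r → 𝕜)
    (h : LinearIndependent 𝕜
      (Sum.elim (fun i : m => J i) (fun i : {i : r // g i = 0} => G i.1))) :
    Function.Injective (fromBlocks J 0 G (diagonal g)).vecMul := by
  classical
  refine (injective_iff_map_eq_zero (fromBlocks J 0 G (diagonal g)).vecMulLinear).2 fun v hv => ?_
  rw [vecMulLinear_apply, vecMul_fromBlocks] at hv
  have hJG : (v ∘ Sum.inl) ᵥ* J + (v ∘ Sum.inr) ᵥ* G = 0 :=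
    funext fun i => congrFun hv (Sum.inl i)
  have hg (i : r) : v (Sum.inr i) = 0 ∨ g i = 0 := by
    simpa [vecMul_diagonal] using congrFun hv (Sum.inr i)
  have hsum : ∑ i : {i : r // g i = 0}, v (Sum.inr i.1) • G i.1 = ∑ i, v (Sum.inr i) • G i :=
    Fintype.sum_of_injective Subtype.val Subtype.val_injective _ _
      (fun i hi => by
        rw [(hg i).resolve_right fun hi0 => hi ⟨⟨i, hi0⟩, rfl⟩, zero_smul])
      fun _ => rfl
  have key := Fintype.linearIndependent_iff.1 h
    (Sum.elim (fun i => v (Sum.inl i)) fun i => v (Sum.inr i.1)) (by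
      simpa [Fintype.sum_sum_type, hsum, vecMul_eq_sum] using hJG)
  ext (i | i)
  · exact key (Sum.inl i)
  · exact (hg i).elim id fun hi => key (Sum.inr ⟨i, hi⟩)

/-- LICQ implies positive definiteness of
`M = [[JJᵀ, JGᵀ], [GJᵀ, GGᵀ + diag(g)²]]`: if the rows of `J` together with the rows `Gᵢ`
of `G` for indices with `gᵢ = 0` are linearly independent, then `M` is positive definite. -/
theorem posDef_fromBlocks_of_licq {d m r : ℕ}
    (J : Matrix (Fin m) (Fin d) ℝ) (G : Matrix (Fin r) (Fin d) ℝ) (g : Fin r → ℝ)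
    (h : LinearIndependent ℝ
      (Sum.elim (fun i : Fin m => J i) (fun i : {i : Fin r // g i = 0} => G i.1))) :
    (Matrix.fromBlocks (J * J.transpose) (J * G.transpose)
        (G * J.transpose) (G * G.transpose + Matrix.diagonal g ^ 2)).PosDef := by
  convert Matrix.PosDef.mul_conjTranspose_self _
    (vecMul_fromBlocks_diagonal_injective J G g h) using 1
  simp [Matrix.fromBlocks_transpose, Matrix.fromBlocks_multiply, pow_two,
    Matrix.conjTranspose_eq_transpose_of_trivial]
end

section
/- Let g : ℝ^d → ℝ^r be continuous and let ε, ν > 0. Let (x*, λ*) ∈ ℝ^d × ℝ^r satisfy g(x*) ≤ 0 componentwise, λ* ≥ 0 componentwise, and ⟨λ*, g(x*)⟩ = 0. Define the active set I = {i : g_i(x*) = 0}, the strongly active set I⁺ = {i ∈ I : λ*_i > 0}, and, for (x, λ) ∈ ℝ^d × ℝ^r, the estimated active set A_{ε,ν}(x, λ) = {i : g_i(x) ≥ −ε q_ν(x, λ) λ_i}. Then there exists δ > 0 such that for all (x, λ) with ‖x − x*‖ ≤ δ and ‖λ − λ*‖ ≤ δ, one has I⁺ ⊆ A_{ε,ν}(x,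 λ) ⊆ I. -/
open scoped BigOperators

/-- `a(x) = ∑ i, max (gᵢ(x), 0)³`. -/
noncomputable def aFun {d r : ℕ} (g : EuclideanSpace ℝ (Fin d) → EuclideanSpace ℝ (Fin r))
    (x : EuclideanSpace ℝ (Fin d)) : ℝ :=
  ∑ i, max (g x i) 0 ^ 3

/-- `q_ν(x, λ) = (ν − a(x)) / (1 + ‖λ‖²)`. -/
noncomputable def qFun {d r : ℕ} (ν : ℝ)
    (g : EuclideanSpace ℝ (Fin d) → EuclideanSpace ℝ (Fin r))
    (x : EuclideanSpace ℝ (Fin d)) (lam : EuclideanSpace ℝ (Fin r)) : ℝ :=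
  (ν - aFun g x) / (1 + ‖lam‖ ^ 2)

lemma continuous_qFun {d r : ℕ} (ν : ℝ)
    {g : EuclideanSpace ℝ (Fin d) → EuclideanSpace ℝ (Fin r)} (hg : Continuous g) :
    Continuous fun p : EuclideanSpace ℝ (Fin d) × EuclideanSpace ℝ (Fin r) =>
      qFun ν g p.1 p.2 := by
  unfold qFun aFun
  refine Continuous.div (by fun_prop) (by fun_prop) fun p => ?_
  positivity

lemma qFun_pos_of_feasible {d r : ℕ} {ν : ℝ} (hν : 0 < ν)
    {g : EuclideanSpace ℝ (Fin d) → EuclideanSpace ℝ (Fin r)} {x : EuclideanSpace ℝ (Fin d)}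
    (hx : ∀ i, g x i ≤ 0) (lam : EuclideanSpace ℝ (Fin r)) : 0 < qFun ν g x lam := by
  have ha : aFun g x = 0 := by simp [aFun, max_eq_right (hx _)]
  rw [qFun, ha, sub_zero]
  positivity

/-- A property holding near `(a, b)` holds on a product of closed balls of equal radius. -/
lemma exists_pos_forall_norm_sub_le {E F : Type*} [SeminormedAddCommGroup E]
    [SeminormedAddCommGroup F] {P : E × F → Prop} {a : E} {b : F} (h : ∀ᶠ p in nhds (a, b), P p) :
    ∃ δ > 0, ∀ x y, ‖x - a‖ ≤ δ → ‖y - b‖ ≤ δ → P (x, y) := by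
  obtain ⟨δ, hδ, hP⟩ := Metric.nhds_basis_closedBall.eventually_iff.1 h
  refine ⟨δ, hδ, fun x y hx hy => hP ?_⟩
  rw [← dist_eq_norm] at hx hy
  exact max_le hx hy

/-- Lemma 3.3: near a primal-dual pair `(x*, λ*)` satisfying feasibility, dual feasibility
and complementarity, the estimated active set `A_{ε,ν}(x, λ) = {i : gᵢ(x) ≥ −ε q_ν(x,λ) λᵢ}`
is sandwiched between the strongly active set `I⁺ = {i : gᵢ(x*) = 0 ∧ λ*ᵢ > 0}` and the
active set `I = {i : gᵢ(x*) = 0}`. -/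
theorem estimated_active_set_sandwich {d r : ℕ} (ε ν : ℝ) (hε : 0 < ε) (hν : 0 < ν)
    (g : EuclideanSpace ℝ (Fin d) → EuclideanSpace ℝ (Fin r)) (hg : Continuous g)
    (xs : EuclideanSpace ℝ (Fin d)) (lams : EuclideanSpace ℝ (Fin r))
    (hfeas : ∀ i, g xs i ≤ 0) (hdual : ∀ i, 0 ≤ lams i)
    (hcomp : ∑ i, lams i * g xs i = 0) :
    ∃ δ > 0, ∀ (x : EuclideanSpace ℝ (Fin d)) (lam : EuclideanSpace ℝ (Fin r)),
      ‖x - xs‖ ≤ δ → ‖lam - lams‖ ≤ δ →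
      ({i | g xs i = 0 ∧ 0 < lams i} ⊆
          {i | -(ε * qFun ν g x lam * lam i) ≤ g x i}) ∧
        ({i | -(ε * qFun ν g x lam * lam i) ≤ g x i} ⊆ {i | g xs i = 0}) := by
  have hmul (i : Fin r) : lams i * g xs i = 0 :=
    (Finset.sum_eq_zero_iff_of_nonpos fun i _ =>
      mul_nonpos_of_nonneg_of_nonpos (hdual i) (hfeas i)).1 hcomp i (Finset.mem_univ i)
  have hq : 0 < qFun ν g xs lams := qFun_pos_of_feasible hν hfeas lams
  have hqc := continuous_qFun ν hg
  have hcont (i : Fin r) : Continuous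
      fun p : EuclideanSpace ℝ (Fin d) × EuclideanSpace ℝ (Fin r) =>
        -(ε * qFun ν g p.1 p.2 * p.2 i) := by fun_prop
  have hgc (i : Fin r) : Continuous
      fun p : EuclideanSpace ℝ (Fin d) × EuclideanSpace ℝ (Fin r) => g p.1 i := by fun_prop
  have hev : ∀ᶠ p : EuclideanSpace ℝ (Fin d) × EuclideanSpace ℝ (Fin r) in nhds (xs, lams),
      ∀ i, (g xs i = 0 ∧ 0 < lams i → -(ε * qFun ν g p.1 p.2 * p.2 i) < g p.1 i) ∧
        (g xs i ≠ 0 → g p.1 i < -(ε * qFun ν g p.1 p.2 * p.2 i)) := by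
    refine Filter.eventually_all.2 fun i => ?_
    simp only [Filter.eventually_and, Filter.eventually_imp_distrib_left]
    refine ⟨fun ⟨hi, hpos⟩ => ?_, fun hi => ?_⟩
    · refine (hcont i).continuousAt.eventually_lt (hgc i).continuousAt ?_
      simp only [hi, Left.neg_neg_iff]
      positivity
    · refine (hgc i).continuousAt.eventually_lt (hcont i).continuousAt ?_
      have hl : lams i = 0 := (mul_eq_zero.1 (hmul i)).resolve_right hi
      simpa [hl] using lt_of_le_of_ne (hfeas i) hi
  obtain ⟨δ, hδ, h⟩ := exists_pos_forall_norm_sub_le hev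
  exact ⟨δ, hδ, fun x lam hx hl =>
    ⟨fun i hi => ((h x lam hx hl i).1 hi).le,
      fun i hi => by_contra fun hne => ((h x lam hx hl i).2 hne).not_ge hi⟩⟩
end

section
/- Let β ∈ (0, 1), κ_grad > 0, κ_f > 0, Υ ≥ 2, α > 0, and let L_t, L_s, L̄_t, L̄_s, D be real numbers with D ≤ 0. Assume: (i) L_s ≤ L_t + α(1 − Υ(κ_grad + 1)α)·D; (ii) |L̄_t − L_t| ≤ −κ_f α² D and |L̄_s − L_s| ≤ −κ_f α² D; and (iii) α ≤ (1 − β)/(Υ(κ_grad + κ_f + 1)). Then L̄_s ≤ L̄_t + β α D. -/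
/-- Lemma 4.4 (concluding step): when the estimates are accurate, any sufficiently
small stepsize satisfies the Armijo condition for the estimated merit values. -/
theorem armijo_of_small_stepsize (β κgrad κf Υ α Lt Ls Lbt Lbs D : ℝ)
    (hβ0 : 0 < β) (hβ1 : β < 1) (hκg : 0 < κgrad) (hκf : 0 < κf) (hΥ : 2 ≤ Υ) (hα : 0 < α)
    (hD : D ≤ 0)
    (h1 : Ls ≤ Lt + α * (1 - Υ * (κgrad + 1) * α) * D)
    (h2 : |Lbt - Lt| ≤ -(κf * α ^ 2 * D))
    (h3 : |Lbs - Ls| ≤ -(κf * α ^ 2 * D))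
    (h4 : α ≤ (1 - β) / (Υ * (κgrad + κf + 1))) :
    Lbs ≤ Lbt + β * α * D := by
  have hα_mul : α * (Υ * (κgrad + κf + 1)) ≤ 1 - β := (le_div_iff₀ (by positivity)).1 h4
  have hκfα : 0 ≤ (Υ - 2) * (κf * α) := mul_nonneg (by linarith) (by positivity)
  have hβ_le : β ≤ 1 - Υ * (κgrad + 1) * α - 2 * κf * α := by linarith
  have hαD : α * D ≤ 0 := mul_nonpos_of_nonneg_of_nonpos hα.le hD
  have hdescent := mul_le_mul_of_nonpos_right hβ_le hαD
  linarith [neg_le_of_abs_le h2, le_of_abs_le h3]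
end

section
/- Let β ∈ (0, 1), α_max > 0, and κ_f with 0 < κ_f ≤ β/(4·α_max). Let 0 < α ≤ α_max and let L_t, L_s, L̄_t, L̄_s, D be real numbers with D ≤ 0. Assume |L̄_t − L_t| ≤ −κ_f α² D, |L̄_s − L_s| ≤ −κ_f α² D, and the Armijo condition for the estimates L̄_s ≤ L̄_t + β α D. Then L_s ≤ L_t + (β α / 2)·D. -/
/-- Lemma 4.5: an Armijo decrease of the estimated merit function implies half the Armijo
decrease of the true merit function, when the merit-function estimates are accurate. -/
theorem true_decrease_of_estimated_armijo (β αmax κf α Lt Ls Lbt Lbs D : ℝ)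
    (hβ0 : 0 < β) (hβ1 : β < 1) (hαmax : 0 < αmax)
    (hκf0 : 0 < κf) (hκf : κf ≤ β / (4 * αmax))
    (hα0 : 0 < α) (hα : α ≤ αmax) (hD : D ≤ 0)
    (h2 : |Lbt - Lt| ≤ -(κf * α ^ 2 * D))
    (h3 : |Lbs - Ls| ≤ -(κf * α ^ 2 * D))
    (harmijo : Lbs ≤ Lbt + β * α * D) :
    Ls ≤ Lt + β * α / 2 * D := by
  have hκα : κf * α ≤ β / 4 := by
    rw [le_div_iff₀ (by positivity)] at hκf
    linarith [mul_le_mul_of_nonneg_left hα hκf0.le]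
  have herr : β * α / 4 * D ≤ κf * α ^ 2 * D :=
    mul_le_mul_of_nonpos_right (by linarith [mul_le_mul_of_nonneg_right hκα hα0.le]) hD
  linarith [(abs_le.mp h2).2, (abs_le.mp h3).1]
end

section
/- Let (Ω, F, (F_t)_{t∈ℕ}, P) be a filtered probability space, let a, b > 0, α > 0, and ℓ* ∈ ℝ. For each t ∈ ℕ let L_t : Ω → ℝ be F_t-measurable and integrable with L_t ≥ ℓ* almost surely, and let R_t : Ω → ℝ be F_t-measurable with R_t² integrable. Suppose that for every t, E[L_{t+1} | F_t] ≤ L_t − a·α·R_t² + b·α² almost surely. Then for every Γ ∈ ℕ, (1/(Γ+1)) Σ_{t=0}^{Γ} E[R_t²] ≤ (E[L₀] − ℓ*)/(a·α·(Γ+1)) + (b/a)·α. -/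
open MeasureTheory

/-- Telescoping of a recursive decrease inequality with constant drift. -/
lemma mul_sum_range_add_le_of_decrease {x r : ℕ → ℝ} {c d : ℝ}
    (h : ∀ t, x (t + 1) ≤ x t - c * r t + d) (n : ℕ) :
    c * ∑ t ∈ Finset.range n, r t + x n ≤ x 0 + n * d := by
  induction n with
  | zero => simp
  | succ n ih =>
    rw [Finset.sum_range_succ]
    push_cast
    linarith [h n]

/-- A conditional expected decrease holds in expectation. -/
lemma integral_le_of_condExp_le_sub_mul_add {Ω : Type*} {m m0 : MeasurableSpace Ω}
    {μ : Measure Ω} [IsProbabilityMeasure μ] (hm : m ≤ m0) {X Y Z : Ω → ℝ} {c d : ℝ}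
    (hY : Integrable Y μ) (hZ : Integrable Z μ)
    (h : ∀ᵐ ω ∂μ, (μ[X | m]) ω ≤ Y ω - c * Z ω + d) :
    ∫ ω, X ω ∂μ ≤ ∫ ω, Y ω ∂μ - c * ∫ ω, Z ω ∂μ + d := by
  have hsub : Integrable (fun ω => Y ω - c * Z ω) μ := hY.sub (hZ.const_mul c)
  calc ∫ ω, X ω ∂μ = ∫ ω, (μ[X | m]) ω ∂μ := (integral_condExp hm).symm
    _ ≤ ∫ ω, (Y ω - c * Z ω + d) ∂μ :=
      integral_mono_ae integrable_condExp (hsub.add (integrable_const d)) h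
    _ = ∫ ω, Y ω ∂μ - c * ∫ ω, Z ω ∂μ + d := by
      rw [integral_add hsub (integrable_const d), integral_sub hY (hZ.const_mul c),
        integral_const_mul]
      simp

/-- Constant-stepsize recursion (Theorem 3.1(a)): if `L_t` is adapted, integrable, bounded
below by `ℓ*`, and satisfies the expected one-step decrease
`E[L_{t+1} | F_t] ≤ L_t − a·α·R_t² + b·α²` a.s., then the averaged expected residuals obey
`(1/(Γ+1)) ∑_{t=0}^Γ E[R_t²] ≤ (E[L₀] − ℓ*)/(a·α·(Γ+1)) + (b/a)·α`. -/
theorem averaged_residual_bound_const_step {Ω : Type*} {m0 : MeasurableSpace Ω}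
    (μ : Measure Ω) [IsProbabilityMeasure μ] (ℱ : Filtration ℕ m0)
    (a b α lstar : ℝ) (ha : 0 < a) (hb : 0 < b) (hα : 0 < α)
    (L R : ℕ → Ω → ℝ)
    (hLmeas : ∀ t, StronglyMeasurable[ℱ t] (L t))
    (hLint : ∀ t, Integrable (L t) μ)
    (hLlb : ∀ t, ∀ᵐ ω ∂μ, lstar ≤ L t ω)
    (hRmeas : ∀ t, StronglyMeasurable[ℱ t] (R t))
    (hRint : ∀ t, Integrable (fun ω => R t ω ^ 2) μ)
    (hrec : ∀ t, ∀ᵐ ω ∂μ,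
      (μ[L (t + 1) | ℱ t]) ω ≤ L t ω - a * α * R t ω ^ 2 + b * α ^ 2) :
    ∀ Γ : ℕ,
      (1 / ((Γ : ℝ) + 1)) * ∑ t ∈ Finset.range (Γ + 1), ∫ ω, R t ω ^ 2 ∂μ ≤
        ((∫ ω, L 0 ω ∂μ) - lstar) / (a * α * ((Γ : ℝ) + 1)) + (b / a) * α := by
  intro Γ
  have hstep (t : ℕ) := integral_le_of_condExp_le_sub_mul_add (ℱ.le t) (hLint t) (hRint t) (hrec t)
  have hsum := mul_sum_range_add_le_of_decrease
    (x := fun t => ∫ ω, L t ω ∂μ) (r := fun t => ∫ ω, R t ω ^ 2 ∂μ) hstep (Γ + 1)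
  have hlow : lstar ≤ ∫ ω, L (Γ + 1) ω ∂μ := by
    simpa using integral_mono_ae (integrable_const lstar) (hLint (Γ + 1)) (hLlb (Γ + 1))
  push_cast at hsum
  have hn : (0 : ℝ) < Γ + 1 := by positivity
  have hrhs : ((∫ ω, L 0 ω ∂μ) - lstar) / (a * α * ((Γ : ℝ) + 1)) + (b / a) * α =
      ((∫ ω, L 0 ω ∂μ) - lstar + (Γ + 1) * (b * α ^ 2)) / (a * α * ((Γ : ℝ) + 1)) := by
    field_simp
  rw [hrhs, le_div_iff₀ (by positivity)]
  calc _ = a * α * ∑ t ∈ Finset.range (Γ + 1), ∫ ω, R t ω ^ 2 ∂μ := by field_simp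
    _ ≤ _ := by linarith
end

section
/- Let (Ω, F, (F_t)_{t∈ℕ}, P) be a filtered probability space, let a, b > 0 and ℓ* ∈ ℝ, and let (α_t)_{t∈ℕ} be positive reals with Σ_{t=0}^{∞} α_t = ∞ and Σ_{t=0}^{∞} α_t² < ∞. For each t ∈ ℕ let L_t : Ω → ℝ be F_t-measurable and integrable with L_t ≥ ℓ* almost surely, and let R_t : Ω → ℝ be F_t-measurable with R_t² integrable. Suppose that for every t, E[L_{t+1} | F_t] ≤ L_t − a·α_t·R_t² + b·α_t² almost surely. Then (Σ_{t=0}^{Γ} α_t E[R_t²]) / (Σ_{t=0}^{Γ} α_t) → 0 as Γ → ∞, and consequently liminf_{t→∞} E[R_t²] = 0. -/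
open MeasureTheory Filter

/-- Real terms whose weighted series converges have vanishing weighted averages when the
weights have divergent sum. -/
theorem tendsto_weighted_average_zero_of_summable {α e : ℕ → ℝ}
    (hdiv : Tendsto (fun n : ℕ => ∑ t ∈ Finset.range n, α t) atTop atTop)
    (hsum : Summable fun t => α t * e t) :
    Tendsto (fun n : ℕ => (∑ t ∈ Finset.range (n + 1), α t * e t) /
      ∑ t ∈ Finset.range (n + 1), α t) atTop (nhds 0) :=
  (hsum.hasSum.tendsto_sum_nat.comp (tendsto_add_atTop_nat 1)).div_atTop
    (hdiv.comp (tendsto_add_atTop_nat 1))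

/-- A nonnegative sequence whose weighted series converges has lower limit zero when the positive
weights have divergent sum. -/
theorem liminf_eq_zero_of_summable_weighted {α e : ℕ → ℝ} (hα : ∀ t, 0 < α t)
    (he : ∀ t, 0 ≤ e t)
    (hdiv : Tendsto (fun n : ℕ => ∑ t ∈ Finset.range n, α t) atTop atTop)
    (hsum : Summable fun t => α t * e t) : liminf e atTop = 0 := by
  have hub : ∀ x ∈ {x | ∀ᶠ t in atTop, x ≤ e t}, x ≤ 0 := by
    intro x hx
    by_contra! hpos
    refine (not_summable_iff_tendsto_nat_atTop_of_nonneg fun t => (hα t).le).2 hdiv ?_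
    refine Summable.of_norm_bounded_eventually_nat (hsum.mul_left x⁻¹) ?_
    filter_upwards [hx] with t ht
    rw [Real.norm_of_nonneg (hα t).le, le_inv_mul_iff₀ hpos, mul_comm]
    exact mul_le_mul_of_nonneg_left ht (hα t).le
  have hmem : (0 : ℝ) ∈ {x | ∀ᶠ t in atTop, x ≤ e t} := Eventually.of_forall he
  rw [liminf_eq]
  exact le_antisymm (csSup_le ⟨0, hmem⟩ hub) (le_csSup ⟨0, hub⟩ hmem)

/-- Telescoping of a perturbed descent recursion: the decreases are summable as soon as the merit
values are bounded below and the perturbations are summable. -/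
theorem summable_of_descent {l d p : ℕ → ℝ} {c : ℝ} (hl : ∀ t, c ≤ l t) (hd : ∀ t, 0 ≤ d t)
    (hp : ∀ t, 0 ≤ p t) (hpsum : Summable p) (hrec : ∀ t, l (t + 1) ≤ l t - d t + p t) :
    Summable d := by
  have htel : ∀ n, ∑ t ∈ Finset.range n, d t ≤ l 0 - l n + ∑ t ∈ Finset.range n, p t := by
    intro n
    induction n with
    | zero => simp
    | succ n ih =>
      rw [Finset.sum_range_succ, Finset.sum_range_succ]
      linarith [hrec n]
  refine summable_of_sum_range_le (c := l 0 - c + ∑' t, p t) hd fun n => ?_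
  linarith [htel n, hl n, hpsum.sum_le_tsum (Finset.range n) fun t _ => hp t]

/-- Decaying-stepsize recursion (Theorem 3.1(b)): if `L_t` is adapted, integrable, bounded
below by `ℓ*`, the stepsizes `α_t > 0` satisfy `∑ α_t = ∞` and `∑ α_t² < ∞`, and the
expected one-step decrease `E[L_{t+1} | F_t] ≤ L_t − a·α_t·R_t² + b·α_t²` holds a.s., then
the weighted averages `(∑_{t≤Γ} α_t E[R_t²])/(∑_{t≤Γ} α_t)` tend to `0` and consequently
`liminf_{t→∞} E[R_t²] = 0`. -/
theorem weighted_residual_decay_step {Ω : Type*} {m0 : MeasurableSpace Ω}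
    (μ : Measure Ω) [IsProbabilityMeasure μ] (ℱ : Filtration ℕ m0)
    (a b lstar : ℝ) (ha : 0 < a) (hb : 0 < b)
    (α : ℕ → ℝ) (hαpos : ∀ t, 0 < α t)
    (hαdiv : Tendsto (fun Γ : ℕ => ∑ t ∈ Finset.range Γ, α t) atTop atTop)
    (hαsq : Summable (fun t => α t ^ 2))
    (L R : ℕ → Ω → ℝ)
    (hLmeas : ∀ t, StronglyMeasurable[ℱ t] (L t))
    (hLint : ∀ t, Integrable (L t) μ)
    (hLlb : ∀ t, ∀ᵐ ω ∂μ, lstar ≤ L t ω)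
    (hRmeas : ∀ t, StronglyMeasurable[ℱ t] (R t))
    (hRint : ∀ t, Integrable (fun ω => R t ω ^ 2) μ)
    (hrec : ∀ t, ∀ᵐ ω ∂μ,
      (μ[L (t + 1) | ℱ t]) ω ≤ L t ω - a * α t * R t ω ^ 2 + b * α t ^ 2) :
    Tendsto (fun Γ : ℕ =>
        (∑ t ∈ Finset.range (Γ + 1), α t * ∫ ω, R t ω ^ 2 ∂μ) /
          ∑ t ∈ Finset.range (Γ + 1), α t) atTop (nhds 0) ∧
      liminf (fun t : ℕ => ∫ ω, R t ω ^ 2 ∂μ) atTop = 0 := by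
  have hstep : ∀ t, ∫ ω, L (t + 1) ω ∂μ ≤
      ∫ ω, L t ω ∂μ - a * (α t * ∫ ω, R t ω ^ 2 ∂μ) + b * α t ^ 2 := by
    intro t
    have hdec := (hRint t).const_mul (a * α t)
    have hsub := (hLint t).sub' hdec
    calc ∫ ω, L (t + 1) ω ∂μ = ∫ ω, (μ[L (t + 1) | ℱ t]) ω ∂μ :=
          (integral_condExp (ℱ.le t)).symm
      _ ≤ ∫ ω, (L t ω - a * α t * R t ω ^ 2 + b * α t ^ 2) ∂μ :=
          integral_mono_ae integrable_condExp (hsub.add (integrable_const _)) (hrec t)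
      _ = _ := by
          rw [integral_add hsub (integrable_const _), integral_sub (hLint t) hdec,
            integral_const_mul, integral_const]
          simp [mul_assoc]
  have hlb : ∀ t, lstar ≤ ∫ ω, L t ω ∂μ := fun t => by
    simpa using integral_mono_ae (integrable_const lstar) (hLint t) (hLlb t)
  have hnonneg : ∀ t, 0 ≤ ∫ ω, R t ω ^ 2 ∂μ := fun t => integral_nonneg fun ω => sq_nonneg _
  have hsum : Summable fun t => α t * ∫ ω, R t ω ^ 2 ∂μ :=
    (summable_mul_left_iff ha.ne').1 <| summable_of_descent hlb
      (fun t => mul_nonneg ha.le (mul_nonneg (hαpos t).le (hnonneg t)))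
      (fun t => mul_nonneg hb.le (sq_nonneg _)) (hαsq.mul_left b) hstep
  exact ⟨tendsto_weighted_average_zero_of_summable hαdiv hsum,
    liminf_eq_zero_of_summable_weighted hαpos hnonneg hαdiv hsum⟩
end

section
/- Let c ∈ ℝ^m, g ∈ ℝ^r, and vectors u_1, …, u_m ∈ ℝ^d and w_1, …, w_r ∈ ℝ^d. Suppose there exists z ∈ ℝ^d such that c_i + ⟨u_i, z⟩ = 0 for every i with c_i ≠ 0, and g_i + ⟨w_i, z⟩ ≤ 0 for every i with g_i > 0. Then for all coefficients a ∈ ℝ^m and b ∈ ℝ^r with a_i ≥ 0 for all i, b_i ≥ 0 for all i, a_i = 0 whenever c_i = 0, b_i = 0 whenever g_i ≤ 0, and (a, b) ≠ 0, one has Σ_{i=1}^m a_i c_i u_i + Σ_{i=1}^r b_i w_i ≠ 0. -/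
open scoped BigOperators RealInnerProductSpace

/-- Positive linear independence from the constraint qualification (4.12): if the linear
system `cᵢ + ⟨uᵢ, z⟩ = 0` (for `cᵢ ≠ 0`), `gᵢ + ⟨wᵢ, z⟩ ≤ 0` (for `gᵢ > 0`) is solvable,
then no nontrivial nonnegative combination `∑ aᵢ cᵢ uᵢ + ∑ bᵢ wᵢ` (supported on
`{cᵢ ≠ 0}` and `{gᵢ > 0}` respectively) vanishes. -/
theorem pos_lin_indep_of_cq {d m r : ℕ} (c : Fin m → ℝ) (g : Fin r → ℝ)
    (u : Fin m → EuclideanSpace ℝ (Fin d)) (w : Fin r → EuclideanSpace ℝ (Fin d))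
    (hsol : ∃ z : EuclideanSpace ℝ (Fin d),
      (∀ i, c i ≠ 0 → c i + ⟪u i, z⟫ = 0) ∧ (∀ i, 0 < g i → g i + ⟪w i, z⟫ ≤ 0)) :
    ∀ (a : Fin m → ℝ) (b : Fin r → ℝ),
      (∀ i, 0 ≤ a i) → (∀ i, 0 ≤ b i) →
      (∀ i, c i = 0 → a i = 0) → (∀ i, g i ≤ 0 → b i = 0) →
      (a ≠ 0 ∨ b ≠ 0) →
      (∑ i, (a i * c i) • u i) + (∑ i, b i • w i) ≠ 0 := by
  obtain ⟨z, hc, hg⟩ := hsol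
  intro a b ha hb hac hbg hne h
  have hinner : ∑ i, a i * c i * ⟪u i, z⟫ + ∑ i, b i * ⟪w i, z⟫ = 0 := by
    simpa [inner_add_left, sum_inner, real_inner_smul_left] using congrArg (fun v => ⟪v, z⟫) h
  have hu : ∀ i, a i * c i * ⟪u i, z⟫ = -(a i * c i ^ 2) := fun i => by
    by_cases hi : c i = 0
    · simp [hi]
    · rw [eq_neg_of_add_eq_zero_right (hc i hi)]
      ring
  have hw : ∀ i, b i * ⟪w i, z⟫ ≤ -(b i * g i) := fun i => by
    rcases le_or_gt (g i) 0 with hi | hi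
    · simp [hbg i hi]
    · nlinarith [mul_nonneg (hb i) (neg_nonneg.2 (hg i hi))]
  have hA : ∀ i ∈ Finset.univ, 0 ≤ a i * c i ^ 2 := fun i _ => mul_nonneg (ha i) (sq_nonneg _)
  have hB : ∀ i ∈ Finset.univ, 0 ≤ b i * g i := fun i _ => by
    rcases le_or_gt (g i) 0 with hi | hi
    · simp [hbg i hi]
    · exact mul_nonneg (hb i) hi.le
  have hsum : ∑ i, a i * c i ^ 2 + ∑ i, b i * g i ≤ 0 := by
    have hle := Finset.sum_le_sum fun i (_ : i ∈ Finset.univ) => hw i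
    simp only [hu, Finset.sum_neg_distrib] at hinner hle
    linarith
  have hA0 := (Finset.sum_eq_zero_iff_of_nonneg hA).1
    (by linarith [Finset.sum_nonneg hA, Finset.sum_nonneg hB])
  have hB0 := (Finset.sum_eq_zero_iff_of_nonneg hB).1
    (by linarith [Finset.sum_nonneg hA, Finset.sum_nonneg hB])
  rcases hne with hne | hne
  · refine hne (funext fun i => ?_)
    rcases mul_eq_zero.1 (hA0 i (Finset.mem_univ i)) with hi | hi
    · exact hi
    · exact hac i (pow_eq_zero_iff two_ne_zero |>.1 hi)
  · refine hne (funext fun i => ?_)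
    rcases mul_eq_zero.1 (hB0 i (Finset.mem_univ i)) with hi | hi
    · exact hi
    · exact hbg i hi.le
end

section
/- Let d, m, r ∈ ℕ and A ⊆ {1, …, r} with complement Aᶜ; for z ∈ ℝ^r write z_A ∈ ℝ^A and z_{Aᶜ} ∈ ℝ^{Aᶜ} for the subvectors and, for a matrix G ∈ ℝ^{r×d}, G_A and G_{Aᶜ} for the corresponding row-submatrices. Let B ∈ ℝ^{d×d}, J ∈ ℝ^{m×d}, G ∈ ℝ^{r×d}, Q ∈ ℝ^{d×(m+r)}, u ∈ ℝ^d, c ∈ ℝ^m, g, λ ∈ ℝ^r, and let ε > 0, q > 0, η ∈ ℝ. Define w ∈ ℝ^r by w_i = g_i for i ∈ A and w_i = −ε q λ_i for i ∉ A; define v = (J u ; G u + Π_{Aᶜ}(diag(g)² λ)) ∈ ℝ^{m+r}, where Π_{Aᶜ} zeroes out the coordinates with index in A; define M = [[JJᵀ, JGᵀ], [GJᵀ, GGᵀ + diag(g)²]] ∈ ℝ^{(m+r)×(m+r)}; and define ∇L⁽¹⁾ ∈ ℝ^{d+m+r} with blocks (u + (1/ε)Jᵀc + (1/(εq))Gᵀw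 + η Q v ; c + η (Mv)_{first m coordinates} ; w + η (Mv)_{last r coordinates}). Suppose Δx ∈ ℝ^d, Δ̃μ ∈ ℝ^m, Δ̃λ_A ∈ ℝ^A satisfy B Δx + Jᵀ Δ̃μ + G_Aᵀ Δ̃λ_A = −(u − G_{Aᶜ}ᵀ λ_{Aᶜ}), J Δx = −c, and G_A Δx = −g_A, and suppose Δμ ∈ ℝ^m, Δλ ∈ ℝ^r satisfy M (Δμ ; Δλ) = −(v + Qᵀ Δx). Then ⟨∇L⁽¹⁾, (Δx ; Δμ ; Δλ)⟩ = −⟨Δx, B Δx⟩ + ⟨c, Δ̃μ + Δμ⟩ + ⟨g_A, Δ̃λ_A + Δλ_A⟩ − (1/ε)‖c‖² − (1/(εq))‖g_A‖² − ε q ⟨Δλ_{Aᶜ}, λ_{Aᶜ}⟩ − η ‖v‖². -/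
open scoped BigOperators Matrix

theorem transpose_mulVec_dotProduct {m n R : Type*} [Fintype m] [Fintype n] [CommSemiring R]
    (P : Matrix m n R) (y : m → R) (x : n → R) :
    P.transpose.mulVec y ⬝ᵥ x = y ⬝ᵥ P.mulVec x := by
  rw [Matrix.mulVec_transpose, Matrix.dotProduct_mulVec]

/-- Exact expansion (B.10)/(B.28) of `(∇L⁽¹⁾)ᵀΔ` along the active-set SQP direction: with
`w` the dual feasibility vector (`wᵢ = gᵢ` on the active set `A`, `wᵢ = −εqλᵢ` off it),
`v = (Ju ; Gu + Π_{Aᶜ}(diag(g)²λ))`, `M` the block matrix, and `∇L⁽¹⁾` the dominating part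
of the augmented Lagrangian gradient, if `(Δx, Δ̃μ, Δ̃λ_A)` solves the active-set SQP system
and `(Δμ, Δλ)` solves the coupled dual system, then
`⟨∇L⁽¹⁾, Δ⟩ = −⟨Δx, BΔx⟩ + ⟨c, Δ̃μ + Δμ⟩ + ⟨g_A, Δ̃λ_A + Δλ_A⟩ − (1/ε)‖c‖² − (1/(εq))‖g_A‖²
− εq⟨Δλ_{Aᶜ}, λ_{Aᶜ}⟩ − η‖v‖²`. -/
theorem gradL1_inner_sqp_direction {d m r : ℕ} (A : Finset (Fin r))
    (B : Matrix (Fin d) (Fin d) ℝ) (J : Matrix (Fin m) (Fin d) ℝ)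
    (G : Matrix (Fin r) (Fin d) ℝ) (Q : Matrix (Fin d) (Fin m ⊕ Fin r) ℝ)
    (u : Fin d → ℝ) (c : Fin m → ℝ) (g lam : Fin r → ℝ)
    (ε q η : ℝ) (hε : 0 < ε) (hq : 0 < q)
    (w : Fin r → ℝ)
    (hw : ∀ i, w i = if i ∈ A then g i else -(ε * q * lam i))
    (v : Fin m ⊕ Fin r → ℝ)
    (hv : v = Sum.elim (J.mulVec u)
      (fun i => G.mulVec u i + if i ∈ A then 0 else g i ^ 2 * lam i))
    (M : Matrix (Fin m ⊕ Fin r) (Fin m ⊕ Fin r) ℝ)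
    (hM : M = Matrix.fromBlocks (J * J.transpose) (J * G.transpose)
      (G * J.transpose) (G * G.transpose + Matrix.diagonal g ^ 2))
    (gradL1x : Fin d → ℝ)
    (hgx : ∀ k, gradL1x k = u k + (1 / ε) * J.transpose.mulVec c k
      + (1 / (ε * q)) * G.transpose.mulVec w k + η * Q.mulVec v k)
    (gradL1mu : Fin m → ℝ)
    (hgmu : ∀ i, gradL1mu i = c i + η * M.mulVec v (Sum.inl i))
    (gradL1lam : Fin r → ℝ)
    (hglam : ∀ i, gradL1lam i = w i + η * M.mulVec v (Sum.inr i))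
    (Δx : Fin d → ℝ) (tmu Δmu : Fin m → ℝ) (tlamA Δlam : Fin r → ℝ)
    (h1 : ∀ k, B.mulVec Δx k + J.transpose.mulVec tmu k + (∑ i ∈ A, G i k * tlamA i)
      = -(u k - ∑ i ∈ Aᶜ, G i k * lam i))
    (h2 : J.mulVec Δx = -c)
    (h3 : ∀ i ∈ A, G.mulVec Δx i = -g i)
    (h4 : M.mulVec (Sum.elim Δmu Δlam) = -(v + Q.transpose.mulVec Δx)) :
    (∑ k, gradL1x k * Δx k) + (∑ i, gradL1mu i * Δmu i) + (∑ i, gradL1lam i * Δlam i)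
      = -(∑ k, Δx k * B.mulVec Δx k)
        + (∑ i, c i * (tmu i + Δmu i)) + (∑ i ∈ A, g i * (tlamA i + Δlam i))
        - (1 / ε) * (∑ i, c i ^ 2) - (1 / (ε * q)) * (∑ i ∈ A, g i ^ 2)
        - ε * q * (∑ i ∈ Aᶜ, Δlam i * lam i)
        - η * (∑ i : Fin m ⊕ Fin r, v i ^ 2) := by
  have hs : M.transpose = M := by
    rw [hM, Matrix.fromBlocks_transpose]
    simp [Matrix.transpose_mul, Matrix.transpose_pow]
  have hdual : (∑ i, M.mulVec v (Sum.inl i) * Δmu i) + (∑ i, M.mulVec v (Sum.inr i) * Δlam i)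
      = -(∑ i, v i ^ 2) - ∑ k, Q.mulVec v k * Δx k := by
    have h : M.mulVec v ⬝ᵥ Sum.elim Δmu Δlam = -(v ⬝ᵥ v) - Q.mulVec v ⬝ᵥ Δx := by
      have hMv : M.mulVec v ⬝ᵥ Sum.elim Δmu Δlam = v ⬝ᵥ M.mulVec (Sum.elim Δmu Δlam) := by
        rw [← transpose_mulVec_dotProduct, hs]
      rw [hMv, h4, dotProduct_neg, dotProduct_add, ← transpose_mulVec_dotProduct,
        Matrix.transpose_transpose]
      ring
    simpa [dotProduct, Fintype.sum_sum_type, sq] using h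
  have hJ (y : Fin m → ℝ) : ∑ k, J.transpose.mulVec y k * Δx k = -∑ i, c i * y i := by
    have h := transpose_mulVec_dotProduct J y Δx
    rw [h2, dotProduct_neg, dotProduct_comm y] at h
    exact h
  have hG (S : Finset (Fin r)) (y : Fin r → ℝ) :
      ∑ k, (∑ i ∈ S, G i k * y i) * Δx k = ∑ i ∈ S, y i * G.mulVec Δx i := by
    simp only [Matrix.mulVec, dotProduct, Finset.sum_mul, Finset.mul_sum]
    rw [Finset.sum_comm]
    exact Finset.sum_congr rfl fun i _ => Finset.sum_congr rfl fun k _ => by ring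
  have hactive (y : Fin r → ℝ) : ∑ i ∈ A, y i * G.mulVec Δx i = -∑ i ∈ A, g i * y i := by
    rw [← Finset.sum_neg_distrib]
    exact Finset.sum_congr rfl fun i hi => by rw [h3 i hi]; ring
  have hwsum (y : Fin r → ℝ) :
      ∑ i, w i * y i = ∑ i ∈ A, g i * y i - ε * q * ∑ i ∈ Aᶜ, y i * lam i := by
    rw [← Finset.sum_add_sum_compl A, Finset.mul_sum, sub_eq_add_neg, ← Finset.sum_neg_distrib]
    congr 1
    · exact Finset.sum_congr rfl fun i hi => by rw [hw i, if_pos hi]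
    · exact Finset.sum_congr rfl fun i hi => by
        rw [hw i, if_neg (Finset.mem_compl.mp hi)]; ring
  have hu : ∑ k, u k * Δx k = -(∑ k, Δx k * B.mulVec Δx k) + (∑ i, c i * tmu i)
      + (∑ i ∈ A, g i * tlamA i) + ∑ i ∈ Aᶜ, G.mulVec Δx i * lam i := by
    have h : ∑ k, u k * Δx k = ∑ k, (-(Δx k * B.mulVec Δx k) - J.transpose.mulVec tmu k * Δx k
        - (∑ i ∈ A, G i k * tlamA i) * Δx k + (∑ i ∈ Aᶜ, G i k * lam i) * Δx k) :=
      Finset.sum_congr rfl fun k _ => by linear_combination Δx k * h1 k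
    rw [h, Finset.sum_add_distrib, Finset.sum_sub_distrib, Finset.sum_sub_distrib,
      Finset.sum_neg_distrib, hJ, hG, hG, hactive]
    simp only [mul_comm (lam _)]
    ring
  have hGw : (1 / (ε * q)) * ∑ k, G.transpose.mulVec w k * Δx k
      = -((1 / (ε * q)) * ∑ i ∈ A, g i ^ 2) - ∑ i ∈ Aᶜ, G.mulVec Δx i * lam i := by
    have h : ∑ k, G.transpose.mulVec w k * Δx k = ∑ i, w i * G.mulVec Δx i :=
      transpose_mulVec_dotProduct G w Δx
    rw [h, hwsum, hactive]
    simp only [← sq]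
    field_simp
  have hc : ∑ k, J.transpose.mulVec c k * Δx k = -∑ i, c i ^ 2 := by
    simp only [hJ, sq]
  simp only [hgx, hgmu, hglam, add_mul, mul_add, mul_assoc, Finset.sum_add_distrib,
    ← Finset.mul_sum]
  simp only [← mul_assoc]
  rw [hc, hu, hGw, hwsum]
  linear_combination η * hdual
end
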